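/- arXiv:2112.03125 — 2 statements merged into one kernel-verified Lean document; each statement's English description precedes it below -/
import Mathlib

section
/- Let k ≥ 0. Every triple (P₁, P₂, P₃) of polynomials in 𝒫_{k−1} admits a unique decomposition P_i = Q_i + R_i (i = 1, 2, 3) with Q_i, R_i ∈ 𝒫_{k−1} such that x Q₁ + y Q₂ + z Q₃ = 0 and such that the row-wise divergence of M(R₁,R₂,R₃) is the gradient of a polynomial of 𝒫_k, i.e. there exists q ∈ 𝒫_k with Σ_{j=1}^{3} ∂_{x_j}(x_j R_i) = ∂_{x_i} q for i = 1, 2, 3. -/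
open MvPolynomial

noncomputable section

/-- Real polynomials in the three variables `x, y, z` (indexed `0, 1, 2`). -/
abbrev P3 := MvPolynomial (Fin 3) ℝ

/-- Membership in `𝒫_m`, the space of polynomials of total degree at most `m`,
with the convention `𝒫_m = {0}` for `m < 0`. -/
def memP (m : ℤ) (p : P3) : Prop := p = 0 ∨ (p.totalDegree : ℤ) ≤ m

/-- The row-wise divergence of the matrix `M(P₁,P₂,P₃)` with entries `M i j = x_j * P i`:
its `i`-th component is `Σ_j ∂_{x_j} (x_j P_i)`. -/
def rowDiv (P : Fin 3 → P3) : Fin 3 → P3 := fun i => ∑ j : Fin 3, pderiv j (X j * P i)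

/-- The total degree of an exponent. -/
def dg (m : Fin 3 →₀ ℕ) : ℕ := m 0 + m 1 + m 2

lemma dg_add_single (m : Fin 3 →₀ ℕ) (i : Fin 3) : dg (m + Finsupp.single i 1) = dg m + 1 := by
  fin_cases i <;> simp [dg, Finsupp.single_apply] <;> omega

lemma dg_sub_single (m : Fin 3 →₀ ℕ) (i : Fin 3) (h : i ∈ m.support) :
    dg (m - Finsupp.single i 1) + 1 = dg m := by
  rw [Finsupp.mem_support_iff] at h
  fin_cases i <;> simp [dg, Finsupp.single_apply] at h ⊢ <;> omega

lemma dg_eq_sum (m : Fin 3 →₀ ℕ) : (m.sum fun _ e => e) = dg m := by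
  rw [Finsupp.sum_fintype _ _ (by simp), Fin.sum_univ_three]; rfl

lemma memP_iff (a : ℤ) (p : P3) : memP a p ↔ ∀ m, coeff m p ≠ 0 → (dg m : ℤ) ≤ a := by
  constructor
  · rintro (rfl | h) m hm
    · simp at hm
    · have := le_totalDegree (mem_support_iff.2 hm)
      rw [dg_eq_sum] at this
      omega
  · intro h
    by_cases hp : p = 0
    · exact Or.inl hp
    right
    obtain ⟨m0, hm0⟩ := ne_zero_iff.1 hp
    have h0 := h m0 hm0
    have : p.totalDegree ≤ a.toNat := by
      unfold totalDegree
      refine Finset.sup_le fun m hm => ?_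
      have := h m (mem_support_iff.1 hm)
      rw [dg_eq_sum]
      omega
    omega

lemma coeff_X_mul_pderiv (m : Fin 3 →₀ ℕ) (j : Fin 3) (p : P3) :
    coeff m (X j * pderiv j p) = (m j : ℝ) * coeff m p := by
  rw [coeff_X_mul']
  split_ifs with h
  · rw [coeff_pderiv]
    rw [Finsupp.mem_support_iff] at h
    have h1 : Finsupp.single j 1 ≤ m := by
      rw [Finsupp.single_le_iff]; omega
    rw [tsub_add_cancel_of_le h1]
    have : (((m - Finsupp.single j 1 : Fin 3 →₀ ℕ) j : ℕ) : ℝ) + 1 = m j := by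
      have : (m - Finsupp.single j 1 : Fin 3 →₀ ℕ) j + 1 = m j := by
        simp; omega
      exact_mod_cast this
    rw [this, mul_comm]
  · rw [Finsupp.notMem_support_iff] at h
    simp [h]

lemma coeff_euler (m : Fin 3 →₀ ℕ) (p : P3) :
    coeff m (∑ j, X j * pderiv j p) = (dg m : ℝ) * coeff m p := by
  rw [coeff_sum]
  simp only [coeff_X_mul_pderiv, Fin.sum_univ_three, dg]
  push_cast; ring

lemma coeff_rowDiv (m : Fin 3 →₀ ℕ) (R : Fin 3 → P3) (i : Fin 3) :
    coeff m (rowDiv R i) = ((dg m : ℝ) + 3) * coeff m (R i) := by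
  have : rowDiv R i = (∑ j, X j * pderiv j (R i)) + C 3 * R i := by
    simp only [rowDiv, Fin.sum_univ_three, pderiv_mul, pderiv_X_self]
    have : (C 3 : P3) = 3 := map_ofNat C 3
    rw [this]; ring
  rw [this, coeff_add, coeff_euler, coeff_C_mul]; ring

lemma coeff_X_rowDiv (m : Fin 3 →₀ ℕ) (R : Fin 3 → P3) :
    coeff m (∑ i, X i * rowDiv R i) = ((dg m : ℝ) + 2) * coeff m (∑ i, X i * R i) := by
  rw [coeff_sum, coeff_sum, Finset.mul_sum]
  refine Finset.sum_congr rfl fun i _ => ?_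
  rw [coeff_X_mul', coeff_X_mul']
  split_ifs with h
  · rw [coeff_rowDiv, ← dg_sub_single m i h]; push_cast; ring
  · simp

lemma uniq_aux (D : Fin 3 → P3) (q : P3) (h : ∑ i, X i * D i = 0)
    (hq : ∀ i, rowDiv D i = pderiv i q) : D = 0 := by
  have hE : ∀ m, (dg m : ℝ) * coeff m q = 0 := by
    intro m
    rw [← coeff_euler]
    simp only [← hq]
    rw [coeff_X_rowDiv, h]; simp
  funext i
  ext m
  have h1 := coeff_rowDiv m D i
  have h2 := hE (m + Finsupp.single i 1)
  rw [dg_add_single] at h2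
  have h3 : coeff (m + Finsupp.single i 1) q = 0 :=
    (mul_eq_zero.1 h2).resolve_left (by positivity)
  rw [hq, coeff_pderiv, h3, zero_mul] at h1
  simpa using (mul_eq_zero.1 h1.symm).resolve_left (by positivity)

/-- Inverse of the Euler operator. -/
def invE (p : P3) : P3 := ∑ m ∈ p.support, monomial m (coeff m p / (dg m : ℝ))

lemma coeff_invE (p : P3) (m : Fin 3 →₀ ℕ) : coeff m (invE p) = coeff m p / (dg m : ℝ) := by
  classical
  simp only [invE, coeff_sum, coeff_monomial]
  rw [Finset.sum_ite_eq']
  split_ifs with h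
  · rfl
  · rw [notMem_support_iff] at h; simp [h]

lemma euler_invE (P : Fin 3 → P3) :
    ∑ j, X j * pderiv j (invE (∑ i, X i * P i)) = ∑ i, X i * P i := by
  ext m
  rw [coeff_euler, coeff_invE]
  by_cases h : dg m = 0
  · have hm : m = 0 := by
      ext i; unfold dg at h; fin_cases i <;> simp <;> omega
    subst hm
    simp [h, Fin.sum_univ_three, coeff_X_mul']
  · have : (dg m : ℝ) ≠ 0 := by exact_mod_cast h
    field_simp

lemma rowDiv_grad (u : P3) (i : Fin 3) :
    rowDiv (fun i => pderiv i u) i = pderiv i ((∑ j, X j * pderiv j u) + C 2 * u) := by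
  ext m
  rw [coeff_rowDiv, coeff_pderiv, coeff_pderiv, coeff_add, coeff_euler, coeff_C_mul, dg_add_single]
  push_cast; ring

lemma memP_add {a : ℤ} {p q : P3} (hp : memP a p) (hq : memP a q) : memP a (p + q) := by
  rw [memP_iff] at *
  intro m hm
  by_cases h : coeff m p = 0
  · exact hq m (by simpa [h] using hm)
  · exact hp m h

lemma memP_C_mul {a : ℤ} {p : P3} (c : ℝ) (hp : memP a p) : memP a (C c * p) := by
  rw [memP_iff] at *
  intro m hm
  rw [coeff_C_mul] at hm
  exact hp m (right_ne_zero_of_mul hm)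

lemma memP_X_mul {a : ℤ} {p : P3} (i : Fin 3) (hp : memP (a - 1) p) : memP a (X i * p) := by
  rw [memP_iff] at *
  intro m hm
  rw [coeff_X_mul'] at hm
  split_ifs at hm with h
  · have := hp _ hm
    have := dg_sub_single m i h
    omega
  · exact absurd rfl hm

lemma memP_pderiv {a : ℤ} {p : P3} (i : Fin 3) (hp : memP a p) : memP (a - 1) (pderiv i p) := by
  rw [memP_iff] at *
  intro m hm
  rw [coeff_pderiv] at hm
  have := hp _ (left_ne_zero_of_mul hm)
  rw [dg_add_single] at this
  push_cast at this
  omega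

lemma memP_invE {a : ℤ} {p : P3} (hp : memP a p) : memP a (invE p) := by
  rw [memP_iff] at *
  intro m hm
  rw [coeff_invE] at hm
  exact hp m fun h => hm (by simp [h])

/-- Every triple `(P₁,P₂,P₃)` of polynomials of `𝒫_{k-1}` decomposes uniquely as
`P = Q + R` with `Qᵢ, Rᵢ ∈ 𝒫_{k-1}`, `x Q₁ + y Q₂ + z Q₃ = 0`, and the row-wise divergence
of `M(R₁,R₂,R₃)` the gradient of a polynomial of `𝒫_k`. -/
theorem trace_free_gradient_decomposition (k : ℕ) (P : Fin 3 → P3)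
    (hdeg : ∀ i, memP ((k : ℤ) - 1) (P i)) :
    ∃! QR : (Fin 3 → P3) × (Fin 3 → P3),
      (∀ i, P i = QR.1 i + QR.2 i) ∧
      (∀ i, memP ((k : ℤ) - 1) (QR.1 i)) ∧
      (∀ i, memP ((k : ℤ) - 1) (QR.2 i)) ∧
      X 0 * QR.1 0 + X 1 * QR.1 1 + X 2 * QR.1 2 = 0 ∧
      ∃ q : P3, memP (k : ℤ) q ∧ ∀ i, rowDiv QR.2 i = pderiv i q := by
  have hS : memP (k : ℤ) (∑ i, X i * P i) := by
    rw [Fin.sum_univ_three]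
    exact memP_add (memP_add (memP_X_mul _ (hdeg 0)) (memP_X_mul _ (hdeg 1)))
      (memP_X_mul _ (hdeg 2))
  have hE := euler_invE P
  have hu := memP_invE hS
  generalize invE (∑ i, X i * P i) = u at hE hu
  refine ⟨(fun i => P i - pderiv i u, fun i => pderiv i u),
    ⟨fun i => by simp, fun i => ?_, fun i => memP_pderiv i hu, ?_,
      _, ?_, rowDiv_grad u⟩, ?_⟩
  · have := memP_add (hdeg i) (memP_C_mul (-1) (memP_pderiv i hu))
    have h2 : P i + C (-1) * pderiv i u = P i - pderiv i u := by simp [sub_eq_add_neg]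
    rwa [h2] at this
  · simp only [Fin.sum_univ_three] at hE
    linear_combination -hE
  · rw [hE]
    exact memP_add hS (memP_C_mul _ hu)
  · rintro ⟨Q, R⟩ ⟨hP, -, -, hQ, q, -, hq⟩
    simp only at hP hQ hq
    have hD := uniq_aux (fun i => R i - pderiv i u) (q - ((∑ j, X j * pderiv j u) + C 2 * u))
      (by
        simp only [Fin.sum_univ_three] at hE ⊢
        linear_combination -hE - hQ - X 0 * hP 0 - X 1 * hP 1 - X 2 * hP 2)
      (fun i => by
        rw [map_sub, ← hq, ← rowDiv_grad]
        simp only [rowDiv, mul_sub, map_sub, Finset.sum_sub_distrib])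
    have hR : ∀ i, R i = pderiv i u := fun i => sub_eq_zero.1 (congrFun hD i)
    refine Prod.ext (funext fun i => ?_) (funext hR)
    simp only [hP i, hR i, add_sub_cancel_right]
end
end

section
/- For all integers k ≥ 0, m ≥ 1 and every ρ ∈ (0,1] there exists a constant C > 0 depending only on k, m and ρ such that: for every bounded open convex polyhedron T ⊂ ℝ³ with m faces, of diameter h_T, containing an open ball of radius ρ h_T, and every polynomial q of total degree at most k, there exists a polynomial P of total degree at most k + 2m such that both P and its gradient ∇P vanish at every point of the topological boundary of T, ∫_T P λ = ∫_T q λ for every polynomial λ of total degree at most k, and C⁻¹ ‖q‖_{L²(T)} ≤ ‖P‖_{L²(T)} ≤ C ‖q‖_{L²(T)}. -/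
open MvPolynomial MeasureTheory
open scoped RealInnerProductSpace

noncomputable section

/-- The `L²(T)` norm of (the function associated with) a polynomial `p`. -/
def polyL2norm (T : Set (EuclideanSpace ℝ (Fin 3))) (p : MvPolynomial (Fin 3) ℝ) : ℝ :=
  Real.sqrt (∫ x in T, (eval (fun i => x i) p) ^ 2)

abbrev E3 := EuclideanSpace ℝ (Fin 3)

lemma ev_cont (p : MvPolynomial (Fin 3) ℝ) :
    Continuous (fun x : E3 => eval (fun i => x i) p) :=
  (MvPolynomial.continuous_eval p).comp (by fun_prop)

lemma int_on {f : E3 → ℝ} (hf : Continuous f) {S : Set E3} (hS : Bornology.IsBounded S) :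
    IntegrableOn f S := by
  have hc : IsCompact (closure S) := hS.isCompact_closure
  exact (hf.continuousOn.integrableOn_compact hc).mono_set subset_closure

lemma poly_zero {U : Set E3} (hU : IsOpen U) (hne : U.Nonempty) (hb : Bornology.IsBounded U)
    (p : MvPolynomial (Fin 3) ℝ) (h : ∫ x in U, (eval (fun i => x i) p) ^ 2 = 0) : p = 0 := by
  have h1 := (integral_eq_zero_iff_of_nonneg (fun x => sq_nonneg _)
    (int_on ((ev_cont p).pow 2) hb)).1 h
  have h2 := Measure.eqOn_open_of_ae_eq h1 hU ((ev_cont p).pow 2).continuousOn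
    continuousOn_const
  obtain ⟨x, hx⟩ := hne
  have hV : IsOpen ((fun y : Fin 3 → ℝ => (WithLp.toLp 2 y : E3)) ⁻¹' U) :=
    hU.preimage (by fun_prop)
  obtain ⟨r, hr, hrU⟩ := Metric.isOpen_iff.1 hV (fun i => x i) hx
  rw [ball_pi _ hr] at hrU
  refine MvPolynomial.funext_set (fun i => Metric.ball (x i) r) (fun i => ?_) ?_
  · rw [Real.ball_eq_Ioo]
    exact Set.Ioo_infinite (by linarith)
  · intro y hy
    have h3 := h2 (hrU hy)
    simpa using h3

lemma memLp_ev (p : MvPolynomial (Fin 3) ℝ) {S : Set E3} (hb : Bornology.IsBounded S) :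
    MemLp (fun x : E3 => eval (fun i => x i) p) 2 (volume.restrict S) :=
  (memLp_two_iff_integrable_sq (ev_cont p).aestronglyMeasurable).2
    (int_on ((ev_cont p).pow 2) hb)

def toL2 (k : ℕ) {S : Set E3} (hb : Bornology.IsBounded S) :
    restrictTotalDegree (Fin 3) ℝ k →ₗ[ℝ] Lp ℝ 2 (volume.restrict S) where
  toFun p := (memLp_ev p.1 hb).toLp _
  map_add' p q := by
    rw [← MemLp.toLp_add]
    congr 1
    funext x
    simp
  map_smul' c p := by
    rw [RingHom.id_apply, ← MemLp.toLp_const_smul]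
    congr 1
    funext x
    simp [smul_eval]

lemma toL2_norm (k : ℕ) {S : Set E3} (hb : Bornology.IsBounded S)
    (p : restrictTotalDegree (Fin 3) ℝ k) :
    ‖toL2 k hb p‖ ^ 2 = ∫ x in S, (eval (fun i => x i) p.1) ^ 2 := by
  rw [← real_inner_self_eq_norm_sq, L2.inner_def]
  refine integral_congr_ae ?_
  filter_upwards [(memLp_ev p.1 hb).coeFn_toLp] with x hx
  simp only [toL2, LinearMap.coe_mk, AddHom.coe_mk, hx]
  simp [sq]

lemma norm_equiv (k : ℕ) {U S : Set E3} (hU : IsOpen U) (hne : U.Nonempty)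
    (hb : Bornology.IsBounded U) (hS : Bornology.IsBounded S) :
    ∃ K > (0 : ℝ), ∀ p : MvPolynomial (Fin 3) ℝ, p.totalDegree ≤ k →
      ∫ x in S, (eval (fun i => x i) p) ^ 2 ≤ K * ∫ x in U, (eval (fun i => x i) p) ^ 2 := by
  have hinj : Function.Injective (toL2 k hb) := by
    rw [← LinearMap.ker_eq_bot, LinearMap.ker_eq_bot']
    intro p hp
    apply Subtype.ext
    apply poly_zero hU hne hb
    rw [← toL2_norm k hb p, hp]
    simp
  let e := LinearEquiv.ofInjective (toL2 k hb) hinj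
  let L := (toL2 k hS).comp e.symm.toLinearMap
  have : FiniteDimensional ℝ (LinearMap.range (toL2 k hb)) := inferInstance
  let L' := LinearMap.toContinuousLinearMap L
  refine ⟨‖L'‖ ^ 2 + 1, by positivity, fun p hp => ?_⟩
  let p' : restrictTotalDegree (Fin 3) ℝ k := ⟨p, (mem_restrictTotalDegree _ _ _).2 hp⟩
  have h1 : ‖toL2 k hS p'‖ ≤ ‖L'‖ * ‖toL2 k hb p'‖ := by
    have := L'.le_opNorm (e p')
    simpa [L', L, e] using this
  have h2 := toL2_norm k hS p'
  have h3 := toL2_norm k hb p'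
  change _ = ∫ x in S, (eval (fun i => x i) p) ^ 2 at h2
  change _ = ∫ x in U, (eval (fun i => x i) p) ^ 2 at h3
  rw [← h2, ← h3]
  have h4 := pow_le_pow_left₀ (norm_nonneg _) h1 2
  nlinarith [sq_nonneg ‖toL2 k hb p'‖]

lemma subst_deg (p : MvPolynomial (Fin 3) ℝ) (f : Fin 3 → MvPolynomial (Fin 3) ℝ)
    (hf : ∀ i, (f i).totalDegree ≤ 1) : (bind₁ f p).totalDegree ≤ p.totalDegree := by
  rw [p.as_sum, map_sum, ← p.as_sum]
  refine totalDegree_finsetSum_le fun s hs => ?_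
  rw [bind₁_monomial]
  refine (totalDegree_mul _ _).trans ?_
  rw [totalDegree_C, zero_add]
  refine (totalDegree_finsetProd _ _).trans ?_
  refine le_trans ?_ (le_totalDegree hs)
  refine Finset.sum_le_sum fun i _ => ?_
  refine (totalDegree_pow _ _).trans ?_
  nlinarith [hf i]

open scoped Pointwise in
lemma ball_scale (f : E3 → ℝ) (x₀ : E3) {h s : ℝ} (hh : 0 < h) :
    ∫ x in Metric.ball x₀ (h * s), f x = h ^ 3 * ∫ x in Metric.ball (0 : E3) s, f (x₀ + h • x) := by
  have h1 := Measure.setIntegral_comp_smul_of_pos (volume : Measure E3)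
    (fun x => f (x₀ + x)) (Metric.ball (0 : E3) s) hh
  have h2 := (measurePreserving_add_left (volume : Measure E3) x₀).setIntegral_preimage_emb
    (MeasurableEquiv.addLeft x₀).measurableEmbedding f (Metric.ball x₀ (h * s))
  rw [h1, ← h2]
  have h3 : h • Metric.ball (0 : E3) s = (fun x => x₀ + x) ⁻¹' Metric.ball x₀ (h * s) := by
    rw [_root_.smul_ball hh.ne']
    ext x
    simp [abs_of_pos hh]
  rw [h3]
  simp
  field_simp

lemma norm_equiv_scaled (k : ℕ) (ρ : ℝ) (hρ : 0 < ρ) :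
    ∃ K > (0 : ℝ), ∀ (x₀ : E3) (h : ℝ), 0 < h → ∀ p : MvPolynomial (Fin 3) ℝ, p.totalDegree ≤ k →
      ∫ x in Metric.ball x₀ (h * 2), (eval (fun i => x i) p) ^ 2 ≤
        K * ∫ x in Metric.ball x₀ (h * (ρ / 2)), (eval (fun i => x i) p) ^ 2 := by
  obtain ⟨K, hK, H⟩ := norm_equiv k (U := Metric.ball (0 : E3) (ρ / 2))
    (S := Metric.ball (0 : E3) 2) Metric.isOpen_ball ⟨0, by simp; positivity⟩
    Metric.isBounded_ball Metric.isBounded_ball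
  refine ⟨K, hK, fun x₀ h hh p hp => ?_⟩
  rw [ball_scale _ _ hh, ball_scale _ _ hh]
  have key := H (bind₁ (fun i => C (x₀ i) + C h * X i) p) ((subst_deg p _ fun i => ?_).trans hp)
  · have he : ∀ x : E3, eval (fun i => x i) (bind₁ (fun i => C (x₀ i) + C h * X i) p)
        = eval (fun i => (x₀ + h • x) i) p := by
      intro x
      have h1 : eval (fun i => x i) (bind₁ (fun i => C (x₀ i) + C h * X i) p) = _ :=
        eval₂Hom_bind₁ (RingHom.id ℝ) (fun i => x i) (fun i => C (x₀ i) + C h * X i) p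
      rw [h1]
      have h2 : (fun i => eval₂Hom (RingHom.id ℝ) (fun i => x i)
          ((fun i => C (x₀ i) + C h * X i : Fin 3 → MvPolynomial (Fin 3) ℝ) i))
          = fun i => (x₀ + h • x) i := by
        funext i
        simp
      rw [h2]
      rfl
    simp only [he] at key
    have := mul_le_mul_of_nonneg_left key (pow_nonneg hh.le 3)
    linarith
  · refine (totalDegree_add _ _).trans (max_le (by simp) ?_)
    refine (totalDegree_mul _ _).trans (by simp)

/-- Solving the moment problem: weighted projection. -/
lemma exists_r (k : ℕ) {T : Set E3} (hT : Bornology.IsBounded T) (b q : MvPolynomial (Fin 3) ℝ)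
    (hpos : ∀ r : MvPolynomial (Fin 3) ℝ, r.totalDegree ≤ k →
      ∫ x in T, (eval (fun i => x i) b) ^ 2 * (eval (fun i => x i) r) ^ 2 = 0 → r = 0) :
    ∃ r : MvPolynomial (Fin 3) ℝ, r.totalDegree ≤ k ∧
      ∀ lam : MvPolynomial (Fin 3) ℝ, lam.totalDegree ≤ k →
        ∫ x in T, eval (fun i => x i) (b ^ 2 * r) * eval (fun i => x i) lam =
        ∫ x in T, eval (fun i => x i) q * eval (fun i => x i) lam := by
  have hint : ∀ p s : MvPolynomial (Fin 3) ℝ,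
      Integrable (fun x : E3 => eval (fun i => x i) p * eval (fun i => x i) s)
        (volume.restrict T) := fun p s => int_on ((ev_cont p).mul (ev_cont s)) hT
  let V := restrictTotalDegree (Fin 3) ℝ k
  let F : MvPolynomial (Fin 3) ℝ →ₗ[ℝ] MvPolynomial (Fin 3) ℝ →ₗ[ℝ] ℝ :=
    LinearMap.mk₂ ℝ (fun p s => ∫ x in T, eval (fun i => x i) p * eval (fun i => x i) s)
      (fun p p' s => by
        rw [← integral_add (hint _ _) (hint _ _)]; simp [add_mul])
      (fun c p s => by
        rw [smul_eq_mul, ← integral_const_mul]; simp [smul_eval, mul_assoc])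
      (fun p s s' => by
        rw [← integral_add (hint _ _) (hint _ _)]; simp [mul_add])
      (fun c p s => by
        rw [smul_eq_mul, ← integral_const_mul]; simp [smul_eval, mul_left_comm])
  let G : V →ₗ[ℝ] Module.Dual ℝ V :=
    (LinearMap.lcomp ℝ ℝ V.subtype).comp
      (F.comp ((LinearMap.mulLeft ℝ (b ^ 2)).comp V.subtype))
  have hG : ∀ r s : V, G r s = ∫ x in T, eval (fun i => x i) (b ^ 2 * r.1) *
      eval (fun i => x i) s.1 := fun r s => rfl
  have hinj : Function.Injective G := by
    rw [← LinearMap.ker_eq_bot, LinearMap.ker_eq_bot']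
    intro r hr
    apply Subtype.ext
    apply hpos r.1 ((mem_restrictTotalDegree _ _ _).1 r.2)
    have := hG r r
    rw [hr, LinearMap.zero_apply] at this
    rw [this]
    congr 1
    funext x
    simp
    ring
  have hsurj : Function.Surjective G :=
    (LinearMap.injective_iff_surjective_of_finrank_eq_finrank
      Subspace.dual_finrank_eq.symm).1 hinj
  obtain ⟨r, hr⟩ := hsurj ((F q).comp V.subtype)
  refine ⟨r.1, (mem_restrictTotalDegree _ _ _).1 r.2, fun lam hl => ?_⟩
  have := hG r ⟨lam, (mem_restrictTotalDegree _ _ _).2 hl⟩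
  rw [hr] at this
  exact this.symm

/-- The affine polynomial of a face. -/
def facePoly (h : ℝ) (v : E3) (c : ℝ) : MvPolynomial (Fin 3) ℝ :=
  C h⁻¹ * (∑ j, C (v j) * X j + C c)

lemma facePoly_eval (h : ℝ) (v : E3) (c : ℝ) (x : E3) :
    eval (fun i => x i) (facePoly h v c) = h⁻¹ * (⟪v, x⟫ + c) := by
  simp [facePoly, PiLp.inner_apply, mul_comm]

lemma facePoly_deg (h : ℝ) (v : E3) (c : ℝ) : (facePoly h v c).totalDegree ≤ 1 := by
  refine (totalDegree_mul _ _).trans ?_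
  rw [totalDegree_C, zero_add]
  refine (totalDegree_add _ _).trans (max_le (totalDegree_finsetSum_le fun i _ => ?_) (by simp))
  exact (totalDegree_mul _ _).trans (by simp)

theorem boundary_vanishing_lift_C1 (k m : ℕ) (hm : 1 ≤ m) (ρ : ℝ)
    (hρ : ρ ∈ Set.Ioc (0 : ℝ) 1) :
    ∃ C > (0 : ℝ),
      ∀ (v : Fin m → EuclideanSpace ℝ (Fin 3)) (c : Fin m → ℝ), (∀ i, ‖v i‖ = 1) →
      ∀ T : Set (EuclideanSpace ℝ (Fin 3)), T = {x | ∀ i, 0 < ⟪v i, x⟫ + c i} →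
        Bornology.IsBounded T →
        (∀ i, ∃ y ∈ closure T, ⟪v i, y⟫ + c i = 0) →
        (∃ x₀, Metric.ball x₀ (ρ * Metric.diam T) ⊆ T) →
        ∀ q : MvPolynomial (Fin 3) ℝ, q.totalDegree ≤ k →
          ∃ P : MvPolynomial (Fin 3) ℝ, P.totalDegree ≤ k + 2 * m ∧
            (∀ x ∈ frontier T, eval (fun i => x i) P = 0) ∧
            (∀ x ∈ frontier T, ∀ j : Fin 3, eval (fun i => x i) (pderiv j P) = 0) ∧
            (∀ lam : MvPolynomial (Fin 3) ℝ, lam.totalDegree ≤ k →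
              ∫ x in T, eval (fun i => x i) P * eval (fun i => x i) lam =
              ∫ x in T, eval (fun i => x i) q * eval (fun i => x i) lam) ∧
            C⁻¹ * polyL2norm T q ≤ polyL2norm T P ∧
            polyL2norm T P ≤ C * polyL2norm T q := by
  obtain ⟨hρ0, hρ1⟩ := hρ
  obtain ⟨K, hK, HK⟩ := norm_equiv_scaled k ρ hρ0
  -- coercivity constant
  set β : ℝ := (ρ / 2) ^ m with hβ
  have hβ0 : 0 < β := by positivity
  set α : ℝ := β ^ 2 / K with hα
  have hα0 : 0 < α := by positivity
  refine ⟨max 1 α⁻¹, by positivity, ?_⟩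
  intro v c hv T hT hTb hface ⟨x₀, hball⟩ q hq
  set h := Metric.diam T with hh
  have hTo : IsOpen T := by
    rw [hT, Set.ofPred_forall]
    exact isOpen_iInter_of_finite fun i => isOpen_lt continuous_const (by fun_prop)
  have hTne : T.Nonempty := by
    obtain ⟨y, hy, -⟩ := hface ⟨0, hm⟩
    exact closure_nonempty_iff.1 ⟨y, hy⟩
  have h0 : 0 < h := by
    obtain ⟨z, hz⟩ := hTne
    obtain ⟨e, he, heT⟩ := Metric.isOpen_iff.1 hTo z hz
    have hw : z + (e / 2) • v ⟨0, hm⟩ ∈ T := by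
      apply heT
      simp [norm_smul, hv, abs_of_pos he]
      linarith
    have := Metric.dist_le_diam_of_mem hTb hw hz
    simp [norm_smul, hv, abs_of_pos he] at this
    linarith
  have hx₀ : x₀ ∈ T := hball (by simp; positivity)
  have hTsub : T ⊆ Metric.ball x₀ (h * 2) := by
    intro y hy
    have := Metric.dist_le_diam_of_mem hTb hy hx₀
    rw [Metric.mem_ball]; linarith
  have hsm : Metric.ball x₀ (h * (ρ / 2)) ⊆ T :=
    (Metric.ball_subset_ball (by nlinarith)).trans hball
  -- the bubble
  set b : MvPolynomial (Fin 3) ℝ := ∏ i, facePoly h (v i) (c i) with hb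
  have hbdeg : b.totalDegree ≤ m := by
    refine (totalDegree_finsetProd _ _).trans ?_
    refine (Finset.sum_le_sum fun i _ => facePoly_deg h (v i) (c i)).trans ?_
    simp
  have hbev : ∀ x : E3, eval (fun i => x i) b = ∏ i, (h⁻¹ * (⟪v i, x⟫ + c i)) := by
    intro x
    simp only [hb, map_prod, facePoly_eval]
  have hTpos : ∀ x ∈ T, ∀ i, 0 < ⟪v i, x⟫ + c i := by
    intro x hx
    rw [hT] at hx
    exact hx
  have hb0 : ∀ x ∈ T, 0 ≤ eval (fun i => x i) b := by
    intro x hx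
    rw [hbev]
    refine Finset.prod_nonneg fun i _ => ?_
    have := hTpos x hx i
    positivity
  have hb1 : ∀ x ∈ T, eval (fun i => x i) b ≤ 1 := by
    intro x hx
    rw [hbev]
    refine Finset.prod_le_one (fun i _ => ?_) (fun i _ => ?_)
    · have := hTpos x hx i
      positivity
    · obtain ⟨y, hy, hy0⟩ := hface i
      have h1 : ⟪v i, x⟫ + c i = ⟪v i, x - y⟫ := by
        rw [inner_sub_right]; linarith
      have h2 := real_inner_le_norm (v i) (x - y)
      rw [hv, one_mul, ← dist_eq_norm] at h2
      have h3 := Metric.dist_le_diam_of_mem hTb.closure (subset_closure hx) hy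
      rw [Metric.diam_closure] at h3
      rw [inv_mul_le_iff₀ h0]
      linarith
  have hbβ : ∀ x ∈ Metric.ball x₀ (h * (ρ / 2)), β ≤ eval (fun i => x i) b := by
    intro x hx
    rw [hbev]
    have : β = ∏ i : Fin m, (ρ / 2) := by
      rw [Finset.prod_const, Finset.card_univ, Fintype.card_fin]
    rw [this]
    refine Finset.prod_le_prod (fun i _ => by positivity) (fun i _ => ?_)
    rw [le_inv_mul_iff₀ h0]
    by_contra hlt
    push Not at hlt
    have hpos := hTpos x (hsm hx) i
    have hmem : x - (⟪v i, x⟫ + c i) • v i ∈ T := by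
      apply hball
      rw [Metric.mem_ball] at hx ⊢
      have h1 : dist (x - (⟪v i, x⟫ + c i) • v i) x = ⟪v i, x⟫ + c i := by
        rw [dist_eq_norm, sub_sub_cancel_left, norm_neg, norm_smul, hv, mul_one,
          Real.norm_of_nonneg hpos.le]
      have h2 := dist_triangle (x - (⟪v i, x⟫ + c i) • v i) x x₀
      nlinarith
    have h3 := hTpos _ hmem i
    rw [inner_sub_right, inner_smul_right, real_inner_self_eq_norm_sq, hv] at h3
    linarith
  have hsq : ∀ p : MvPolynomial (Fin 3) ℝ, ∀ S : Set E3, Bornology.IsBounded S →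
      IntegrableOn (fun x : E3 => (eval (fun i => x i) p) ^ 2) S :=
    fun p S hS => int_on ((ev_cont p).pow 2) hS
  have hcoer : ∀ r : MvPolynomial (Fin 3) ℝ, r.totalDegree ≤ k →
      α * ∫ x in T, (eval (fun i => x i) r) ^ 2 ≤
      ∫ x in T, (eval (fun i => x i) b) ^ 2 * (eval (fun i => x i) r) ^ 2 := by
    intro r hr
    have h1 : ∫ x in T, (eval (fun i => x i) r) ^ 2 ≤
        ∫ x in Metric.ball x₀ (h * 2), (eval (fun i => x i) r) ^ 2 :=
      setIntegral_mono_set (hsq r _ Metric.isBounded_ball)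
        (Filter.Eventually.of_forall fun x => sq_nonneg _) hTsub.eventuallyLE
    have h2 := HK x₀ h h0 r hr
    have hbr : Continuous fun x : E3 =>
        (eval (fun i => x i) b) ^ 2 * (eval (fun i => x i) r) ^ 2 :=
      ((ev_cont b).pow 2).mul ((ev_cont r).pow 2)
    have h3 : ∫ x in Metric.ball x₀ (h * (ρ / 2)), β ^ 2 * (eval (fun i => x i) r) ^ 2 ≤
        ∫ x in Metric.ball x₀ (h * (ρ / 2)),
          (eval (fun i => x i) b) ^ 2 * (eval (fun i => x i) r) ^ 2 := by
      refine setIntegral_mono_on ((hsq r _ Metric.isBounded_ball).const_mul _)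
        (int_on hbr Metric.isBounded_ball) measurableSet_ball fun x hx => ?_
      exact mul_le_mul_of_nonneg_right (pow_le_pow_left₀ hβ0.le (hbβ x hx) 2) (sq_nonneg _)
    have h4 : ∫ x in Metric.ball x₀ (h * (ρ / 2)),
          (eval (fun i => x i) b) ^ 2 * (eval (fun i => x i) r) ^ 2 ≤
        ∫ x in T, (eval (fun i => x i) b) ^ 2 * (eval (fun i => x i) r) ^ 2 :=
      setIntegral_mono_set (int_on hbr hTb)
        (Filter.Eventually.of_forall fun x => by positivity) hsm.eventuallyLE
    rw [integral_const_mul] at h3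
    have h5 := mul_le_mul_of_nonneg_left (h1.trans h2) hα0.le
    have h6 : α * (K * ∫ x in Metric.ball x₀ (h * (ρ / 2)), (eval (fun i => x i) r) ^ 2) =
        β ^ 2 * ∫ x in Metric.ball x₀ (h * (ρ / 2)), (eval (fun i => x i) r) ^ 2 := by
      rw [hα]; field_simp
    linarith
  obtain ⟨r, hr, hmom⟩ := exists_r k hTb b q (by
    intro r hr hz
    apply poly_zero hTo hTne hTb
    have h1 := hcoer r hr
    rw [hz] at h1
    have h2 : 0 ≤ ∫ x in T, (eval (fun i => x i) r) ^ 2 :=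
      integral_nonneg fun x => sq_nonneg _
    nlinarith)
  have hbz : ∀ x ∈ frontier T, eval (fun i => x i) b = 0 := by
    intro x hx
    rw [hTo.frontier_eq] at hx
    obtain ⟨hxc, hxn⟩ := hx
    have h1 : ∃ i, ⟪v i, x⟫ + c i ≤ 0 := by
      rw [hT] at hxn
      simpa using hxn
    obtain ⟨i, hi⟩ := h1
    have h2 : 0 ≤ ⟪v i, x⟫ + c i := by
      have hcl : IsClosed {y : E3 | 0 ≤ ⟪v i, y⟫ + c i} :=
        isClosed_le continuous_const (by fun_prop)
      exact closure_minimal (fun y hy => (hTpos y hy i).le) hcl hxc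
    rw [hbev]
    refine Finset.prod_eq_zero (Finset.mem_univ i) ?_
    rw [le_antisymm hi h2, mul_zero]
  have hI : ∀ p s : MvPolynomial (Fin 3) ℝ,
      IntegrableOn (fun x : E3 => eval (fun i => x i) p * eval (fun i => x i) s) T :=
    fun p s => int_on ((ev_cont p).mul (ev_cont s)) hTb
  refine ⟨b ^ 2 * r, ?_, ?_, ?_, hmom, ?_, ?_⟩
  · refine (totalDegree_mul _ _).trans ?_
    have := totalDegree_pow b 2
    omega
  · intro x hx
    simp [hbz x hx]
  · intro x hx j
    simp [Derivation.leibniz, Derivation.leibniz_pow, hbz x hx]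
  · -- lower bound
    have hle : ∫ x in T, (eval (fun i => x i) q) ^ 2 ≤
        ∫ x in T, (eval (fun i => x i) (b ^ 2 * r)) ^ 2 := by
      have h1 := hmom q hq
      have h2 : ∫ x in T, eval (fun i => x i) (b ^ 2 * r) * eval (fun i => x i) q ≤
          ∫ x in T, ((1 / 2) * (eval (fun i => x i) (b ^ 2 * r)) ^ 2 +
            (1 / 2) * (eval (fun i => x i) q) ^ 2) := by
        refine integral_mono (hI _ _)
          (((hsq _ T hTb).const_mul _).add ((hsq _ T hTb).const_mul _)) fun x => ?_
        beta_reduce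
        nlinarith [sq_nonneg (eval (fun i => x i) (b ^ 2 * r) - eval (fun i => x i) q)]
      rw [integral_add ((hsq _ T hTb).const_mul _) ((hsq _ T hTb).const_mul _),
        integral_const_mul, integral_const_mul, h1] at h2
      simp only [← sq] at h2
      linarith
    have h3 : polyL2norm T q ≤ polyL2norm T (b ^ 2 * r) := Real.sqrt_le_sqrt hle
    refine le_trans ?_ h3
    have h4 : (max 1 α⁻¹)⁻¹ ≤ 1 := inv_le_one_of_one_le₀ (le_max_left _ _)
    have h5 : 0 ≤ polyL2norm T q := Real.sqrt_nonneg _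
    nlinarith
  · -- upper bound
    have hPr : ∫ x in T, (eval (fun i => x i) (b ^ 2 * r)) ^ 2 ≤
        ∫ x in T, (eval (fun i => x i) r) ^ 2 := by
      refine setIntegral_mono_on (hsq _ T hTb) (hsq _ T hTb) hTo.measurableSet fun x hx => ?_
      rw [map_mul, map_pow, mul_pow, ← pow_mul]
      exact mul_le_of_le_one_left (sq_nonneg _) (pow_le_one₀ (hb0 x hx) (hb1 x hx))
    have hrq : ∫ x in T, (eval (fun i => x i) r) ^ 2 ≤
        (α⁻¹) ^ 2 * ∫ x in T, (eval (fun i => x i) q) ^ 2 := by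
      have h1 := hmom r hr
      have h1' : ∫ x in T, eval (fun i => x i) (b ^ 2 * r) * eval (fun i => x i) r =
          ∫ x in T, (eval (fun i => x i) b) ^ 2 * (eval (fun i => x i) r) ^ 2 := by
        congr 1
        funext x
        simp
        ring
      have h2 : ∫ x in T, eval (fun i => x i) q * eval (fun i => x i) r ≤
          ∫ x in T, ((α⁻¹ / 2) * (eval (fun i => x i) q) ^ 2 +
            (α / 2) * (eval (fun i => x i) r) ^ 2) := by
        refine integral_mono (hI _ _)
          (((hsq _ T hTb).const_mul _).add ((hsq _ T hTb).const_mul _)) fun x => ?_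
        beta_reduce
        generalize eval (fun i => x i) q = s
        generalize eval (fun i => x i) r = t
        have e : (α⁻¹ / 2) * s ^ 2 + (α / 2) * t ^ 2 - s * t = (α⁻¹ / 2) * (s - α * t) ^ 2 := by
          field_simp
          ring
        have : 0 ≤ (α⁻¹ / 2) * (s - α * t) ^ 2 := by positivity
        linarith
      rw [integral_add ((hsq _ T hTb).const_mul _) ((hsq _ T hTb).const_mul _),
        integral_const_mul, integral_const_mul] at h2
      have h3 := hcoer r hr
      rw [← h1', h1] at h3
      have h4 : α * ∫ x in T, (eval (fun i => x i) r) ^ 2 ≤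
          α⁻¹ * ∫ x in T, (eval (fun i => x i) q) ^ 2 := by linarith
      rw [sq, mul_assoc, le_inv_mul_iff₀ hα0]
      exact h4
    have h5 : polyL2norm T (b ^ 2 * r) ≤ α⁻¹ * polyL2norm T q := by
      have := Real.sqrt_le_sqrt (hPr.trans hrq)
      rwa [Real.sqrt_mul (by positivity), Real.sqrt_sq (by positivity)] at this
    refine h5.trans (mul_le_mul_of_nonneg_right (le_max_right _ _) (Real.sqrt_nonneg _))
end
end
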